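/- arXiv:1707.01569 — 2 statements merged into one kernel-verified Lean document; each statement's English description precedes it below -/
import Mathlib

section
/- For z = x+iy in the unit disk and λ > 1, the inequality 4λ²|1-z|² - |(1+λ)(1-|z|²) - 2·conj(z)·(1-z)|² ≥ 0 holds; equivalently, (1-|z|²)·|((1+λ)/2)·(1/(1-z)) - conj(z)/(1-|z|²)| ≤ λ for all z ∈ D. -/
open Complex Metric

/-- Pre-Schwarzian derivative of an analytic function. -/
noncomputable def pd (F : ℂ → ℂ) (z : ℂ) : ℂ := deriv (deriv F) z / deriv F z

/-- Dilatation of the harmonic mapping `h + conj g`. -/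
noncomputable def dil (h g : ℂ → ℂ) (z : ℂ) : ℂ := deriv g z / deriv h z

/-- Pre-Schwarzian derivative of the harmonic mapping `h + conj g`. -/
noncomputable def PH (h g : ℂ → ℂ) (z : ℂ) : ℂ :=
  pd h z - (starRingEnd ℂ) (dil h g z) * deriv (dil h g) z / ((1 - ‖dil h g z‖ ^ 2 : ℝ) : ℂ)

/-- Pre-Schwarzian norm. -/
noncomputable def pnorm (P : ℂ → ℂ) : ℝ :=
  ⨆ z : Metric.ball (0 : ℂ) 1, (1 - ‖(z : ℂ)‖ ^ 2) * ‖P (z : ℂ)‖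

/-- The range whose boundedness expresses finiteness of the pre-Schwarzian norm. -/
def pbdd (P : ℂ → ℂ) : Prop :=
  BddAbove (Set.range fun z : Metric.ball (0 : ℂ) 1 => (1 - ‖(z : ℂ)‖ ^ 2) * ‖P (z : ℂ)‖)

/-- `h + conj g` is a sense-preserving harmonic mapping in the unit disk. -/
def SPH (h g : ℂ → ℂ) : Prop :=
  DifferentiableOn ℂ h (Metric.ball (0 : ℂ) 1) ∧
  DifferentiableOn ℂ g (Metric.ball (0 : ℂ) 1) ∧ g 0 = 0 ∧
  ∀ z ∈ Metric.ball (0 : ℂ) 1, ‖deriv g z‖ < ‖deriv h z‖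

theorem one_sub_norm_sq_le_two_mul_norm_one_sub {z : ℂ} (hz : ‖z‖ < 1) :
    1 - ‖z‖ ^ 2 ≤ 2 * ‖1 - z‖ := by
  have h : 1 - ‖z‖ ≤ ‖1 - z‖ := by simpa using norm_sub_norm_le (1 : ℂ) z
  nlinarith [norm_nonneg z]

theorem preSchwarzian_numerator_eq (lam : ℝ) (z : ℂ) :
    ((1 + lam : ℝ) : ℂ) * ((1 - ‖z‖ ^ 2 : ℝ) : ℂ) - 2 * (starRingEnd ℂ) z * (1 - z) =
      (((lam - 1) * (1 - ‖z‖ ^ 2) : ℝ) : ℂ) + 2 * (starRingEnd ℂ) (1 - z) := by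
  have h := Complex.mul_conj' z
  push_cast
  rw [map_sub, map_one, ← h]
  ring

theorem norm_preSchwarzian_numerator_le {lam : ℝ} (hl : 1 ≤ lam) {z : ℂ} (hz : ‖z‖ < 1) :
    ‖((1 + lam : ℝ) : ℂ) * ((1 - ‖z‖ ^ 2 : ℝ) : ℂ) - 2 * (starRingEnd ℂ) z * (1 - z)‖ ≤
      2 * lam * ‖1 - z‖ := by
  have hN : 0 ≤ 1 - ‖z‖ ^ 2 := by nlinarith [norm_nonneg z]
  rw [preSchwarzian_numerator_eq]
  calc
    _ ≤ ‖(((lam - 1) * (1 - ‖z‖ ^ 2) : ℝ) : ℂ)‖ + ‖2 * (starRingEnd ℂ) (1 - z)‖ := norm_add_le _ _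
    _ = (lam - 1) * (1 - ‖z‖ ^ 2) + 2 * ‖1 - z‖ := by
      rw [Complex.norm_of_nonneg (mul_nonneg (sub_nonneg.2 hl) hN), norm_mul, Complex.norm_conj,
        Complex.norm_ofNat]
    _ ≤ 2 * lam * ‖1 - z‖ := by
      nlinarith [mul_le_mul_of_nonneg_left (one_sub_norm_sq_le_two_mul_norm_one_sub hz)
        (sub_nonneg.2 hl)]

theorem stmt11 (lam : ℝ) (hl : 1 < lam) (z : ℂ) (hz : z ∈ Metric.ball (0 : ℂ) 1) :
    0 ≤ 4 * lam ^ 2 * ‖1 - z‖ ^ 2 -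
        ‖((1 + lam : ℝ) : ℂ) * ((1 - ‖z‖ ^ 2 : ℝ) : ℂ) - 2 * (starRingEnd ℂ) z * (1 - z)‖ ^ 2 ∧
    (1 - ‖z‖ ^ 2) *
        ‖(((1 + lam : ℝ) : ℂ) / 2) * (1 / (1 - z)) -
          (starRingEnd ℂ) z / ((1 - ‖z‖ ^ 2 : ℝ) : ℂ)‖ ≤ lam := by
  have hz1 : ‖z‖ < 1 := by simpa using hz
  have hle := norm_preSchwarzian_numerator_le hl.le hz1
  have hN : 0 < 1 - ‖z‖ ^ 2 := by nlinarith [norm_nonneg z]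
  have hw : 1 - z ≠ 0 := by
    rintro h
    rw [← sub_eq_zero.1 h, norm_one] at hz1
    exact lt_irrefl _ hz1
  constructor
  · have h := pow_le_pow_left₀ (norm_nonneg _) hle 2
    rw [mul_pow, mul_pow] at h
    linarith
  · have hNC : ((1 - ‖z‖ ^ 2 : ℝ) : ℂ) ≠ 0 := Complex.ofReal_ne_zero.2 hN.ne'
    have heq : (((1 + lam : ℝ) : ℂ) / 2) * (1 / (1 - z)) -
        (starRingEnd ℂ) z / ((1 - ‖z‖ ^ 2 : ℝ) : ℂ) =
        (((1 + lam : ℝ) : ℂ) * ((1 - ‖z‖ ^ 2 : ℝ) : ℂ) - 2 * (starRingEnd ℂ) z * (1 - z)) /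
          (2 * (1 - z) * ((1 - ‖z‖ ^ 2 : ℝ) : ℂ)) := by
      generalize ((1 - ‖z‖ ^ 2 : ℝ) : ℂ) = N at hNC ⊢
      field_simp
    have hw' : 0 < ‖1 - z‖ := norm_pos_iff.2 hw
    rw [heq, norm_div, norm_mul (2 * (1 - z)), Complex.norm_of_nonneg hN.le, norm_mul 2,
      Complex.norm_ofNat, ← mul_div_assoc, div_le_iff₀ (by positivity)]
    calc
      _ ≤ (1 - ‖z‖ ^ 2) * (2 * lam * ‖1 - z‖) := mul_le_mul_of_nonneg_left hle hN.le
      _ = _ := by ring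
end

section
/- Let f = h + conj(g) be a sense-preserving harmonic mapping in D and F = H + conj(G) a sense-preserving harmonic mapping with ||P_F|| < ∞, such that h' = H'∘φ for some analytic φ: D → D. Then ||P_f|| ≤ ||P_F|| + 2. -/
open Complex Metric

/-- The disk automorphism `w ↦ (w + a) / (1 + conj a * w)`. -/
noncomputable def diskShift (a w : ℂ) : ℂ := (w + a) / (1 + (starRingEnd ℂ) a * w)

lemma one_add_conj_mul_ne_zero {a w : ℂ} (ha : ‖a‖ < 1) (hw : ‖w‖ < 1) :
    1 + (starRingEnd ℂ) a * w ≠ 0 := by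
  intro h
  have h1 : (starRingEnd ℂ) a * w = -1 := by linear_combination h
  have h2 : ‖a‖ * ‖w‖ = 1 := by
    have := congrArg norm h1
    simpa using this
  nlinarith [norm_nonneg a, norm_nonneg w]

lemma hasDerivAt_diskShift {a w : ℂ} (ha : ‖a‖ < 1) (hw : ‖w‖ < 1) :
    HasDerivAt (diskShift a)
      ((1 - (starRingEnd ℂ) a * a) / (1 + (starRingEnd ℂ) a * w) ^ 2) w := by
  have h := ((hasDerivAt_id w).add_const a).div
    (((hasDerivAt_id w).const_mul ((starRingEnd ℂ) a)).const_add 1)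
    (one_add_conj_mul_ne_zero ha hw)
  refine h.congr_deriv ?_
  simp only [id]
  ring

lemma norm_diskShift_lt_one {a w : ℂ} (ha : ‖a‖ < 1) (hw : ‖w‖ < 1) : ‖diskShift a w‖ < 1 := by
  have h0 := norm_pos_iff.2 (one_add_conj_mul_ne_zero ha hw)
  rw [diskShift, norm_div, div_lt_one h0]
  refine lt_of_pow_lt_pow_left₀ 2 h0.le ?_
  have ha2 : ‖a‖ ^ 2 < 1 := by nlinarith [norm_nonneg a]
  have hw2 : ‖w‖ ^ 2 < 1 := by nlinarith [norm_nonneg w]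
  rw [Complex.sq_norm, Complex.normSq_apply] at ha2 hw2 ⊢
  rw [Complex.sq_norm, Complex.normSq_apply]
  simp only [add_re, add_im, one_re, one_im, mul_re, mul_im, conj_re, conj_im]
  nlinarith [mul_pos (sub_pos.2 ha2) (sub_pos.2 hw2)]

/-- The **Schwarz–Pick lemma** in infinitesimal form. -/
theorem schwarz_pick_deriv {ω : ℂ → ℂ} (hd : DifferentiableOn ℂ ω (ball 0 1))
    (hm : Set.MapsTo ω (ball 0 1) (ball 0 1)) {z : ℂ} (hz : z ∈ ball (0 : ℂ) 1) :
    (1 - ‖z‖ ^ 2) * ‖deriv ω z‖ ≤ 1 - ‖ω z‖ ^ 2 := by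
  have hz1 : ‖z‖ < 1 := mem_ball_zero_iff.1 hz
  have hb : ‖ω z‖ < 1 := mem_ball_zero_iff.1 (hm hz)
  have hb' : ‖-ω z‖ < 1 := by rwa [norm_neg]
  have h1 (w : ℂ) (hw : w ∈ ball (0 : ℂ) 1) : diskShift z w ∈ ball (0 : ℂ) 1 :=
    mem_ball_zero_iff.2 (norm_diskShift_lt_one hz1 (mem_ball_zero_iff.1 hw))
  have h2 (w : ℂ) (hw : w ∈ ball (0 : ℂ) 1) : ‖ω (diskShift z w)‖ < 1 :=
    mem_ball_zero_iff.1 (hm (h1 w hw))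
  have hs : diskShift z 0 = z := by simp [diskShift]
  have hψ0 : diskShift (-ω z) (ω (diskShift z 0)) = 0 := by rw [hs]; simp [diskShift]
  have hder (w : ℂ) (hw : w ∈ ball (0 : ℂ) 1) :=
    (hasDerivAt_diskShift hb' (h2 w hw)).comp w
      ((hd.differentiableAt (isOpen_ball.mem_nhds (h1 w hw))).hasDerivAt.comp w
        (hasDerivAt_diskShift hz1 (mem_ball_zero_iff.1 hw)))
  have key := norm_deriv_le_one_of_mapsTo_ball (c := 0) (R := 1)
    (f := diskShift (-ω z) ∘ (ω ∘ diskShift z))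
    (fun w hw => (hder w hw).differentiableAt.differentiableWithinAt)
    (fun w hw => by
      simp only [Function.comp_apply, hψ0]
      exact mem_closedBall_zero_iff.2 (norm_diskShift_lt_one hb' (h2 w hw)).le)
    one_pos
  rw [(hder 0 (mem_ball_self one_pos)).deriv, hs] at key
  have hsq (a : ℂ) : (starRingEnd ℂ) a * a = ((‖a‖ ^ 2 : ℝ) : ℂ) := by
    rw [mul_comm, mul_conj, normSq_eq_norm_sq]
  have hpz : 0 < 1 - ‖z‖ ^ 2 := by nlinarith [norm_nonneg z]
  have hpb : 0 < 1 - ‖ω z‖ ^ 2 := by nlinarith [norm_nonneg (ω z)]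
  have hn {r : ℝ} (hr : 0 < r) : ‖(r : ℂ)‖ = r := by
    rw [norm_real, Real.norm_of_nonneg hr.le]
  have e1 : 1 - (starRingEnd ℂ) z * z = ((1 - ‖z‖ ^ 2 : ℝ) : ℂ) := by rw [hsq]; push_cast; ring
  have e2 : 1 - (starRingEnd ℂ) (-ω z) * (-ω z) = ((1 - ‖ω z‖ ^ 2 : ℝ) : ℂ) := by
    rw [hsq, norm_neg]; push_cast; ring
  have e3 : 1 + (starRingEnd ℂ) (-ω z) * ω z = ((1 - ‖ω z‖ ^ 2 : ℝ) : ℂ) := by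
    rw [map_neg, neg_mul, hsq]; push_cast; ring
  rw [e1, e2, e3, norm_mul, norm_mul, norm_div, norm_div, norm_pow, hn hpz, hn hpb] at key
  simp only [mul_zero, add_zero, one_pow, norm_one, div_one] at key
  rw [sq (1 - _), div_mul_cancel_left₀ hpb.ne', inv_mul_le_iff₀ hpb, mul_one] at key
  linarith

lemma one_sub_sq_norm_pos {z : ℂ} (hz : z ∈ ball (0 : ℂ) 1) : 0 < 1 - ‖z‖ ^ 2 := by
  have := mem_ball_zero_iff.1 hz
  nlinarith [norm_nonneg z]

/-- Pointwise, the pre-Schwarzian derivatives of `h + conj g` and of `h` differ by at most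
`1 / (1 - ‖z‖ ^ 2)`. -/
lemma SPH.norm_PH_sub_pd_le {h g : ℂ → ℂ} (hf : SPH h g) {z : ℂ} (hz : z ∈ ball (0 : ℂ) 1) :
    (1 - ‖z‖ ^ 2) * ‖PH h g z - pd h z‖ ≤ 1 := by
  obtain ⟨hh, hg, -, hlt⟩ := hf
  have hne (w : ℂ) (hw : w ∈ ball (0 : ℂ) 1) : 0 < ‖deriv h w‖ :=
    (norm_nonneg _).trans_lt (hlt w hw)
  have hd : DifferentiableOn ℂ (dil h g) (ball 0 1) :=
    (hg.deriv isOpen_ball).div (hh.deriv isOpen_ball) fun w hw => norm_pos_iff.1 (hne w hw)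
  have hm : Set.MapsTo (dil h g) (ball 0 1) (ball 0 1) := fun w hw => by
    rw [mem_ball_zero_iff, dil, norm_div, div_lt_one (hne w hw)]
    exact hlt w hw
  have hp := one_sub_sq_norm_pos (hm hz)
  have hw1 : ‖dil h g z‖ < 1 := mem_ball_zero_iff.1 (hm hz)
  have hsp := schwarz_pick_deriv hd hm hz
  have hz0 := one_sub_sq_norm_pos hz
  have e : PH h g z - pd h z = -((starRingEnd ℂ) (dil h g z) * deriv (dil h g) z /
      ((1 - ‖dil h g z‖ ^ 2 : ℝ) : ℂ)) := by rw [PH]; ring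
  rw [e, norm_neg, norm_div, norm_mul, RCLike.norm_conj, norm_real, Real.norm_of_nonneg hp.le,
    ← mul_div_assoc, div_le_one hp]
  have := norm_nonneg (deriv (dil h g) z)
  nlinarith [mul_nonneg (mul_nonneg hz0.le this) (sub_pos.2 hw1).le]

/-- The pre-Schwarzian derivative under subordination of derivatives. -/
lemma pd_eq_of_deriv_eq_comp {h H φ : ℂ → ℂ} (hH : DifferentiableOn ℂ H (ball 0 1))
    (hφ : DifferentiableOn ℂ φ (ball 0 1)) (hφmap : Set.MapsTo φ (ball 0 1) (ball 0 1))
    (hsub : ∀ z ∈ ball (0 : ℂ) 1, deriv h z = deriv H (φ z)) {z : ℂ}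
    (hz : z ∈ ball (0 : ℂ) 1) : pd h z = pd H (φ z) * deriv φ z := by
  have he : deriv h =ᶠ[nhds z] deriv H ∘ φ :=
    Filter.eventually_of_mem (isOpen_ball.mem_nhds hz) hsub
  rw [pd, pd, he.deriv_eq, hsub z hz, deriv_comp z
    ((hH.deriv isOpen_ball).differentiableAt (isOpen_ball.mem_nhds (hφmap hz)))
    (hφ.differentiableAt (isOpen_ball.mem_nhds hz))]
  ring

theorem stmt19 (h g H G φ : ℂ → ℂ)
    (hf : SPH h g) (hF : SPH H G) (hFfin : pbdd (PH H G))
    (hφ : DifferentiableOn ℂ φ (Metric.ball (0 : ℂ) 1))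
    (hφmap : Set.MapsTo φ (Metric.ball (0 : ℂ) 1) (Metric.ball (0 : ℂ) 1))
    (hsub : ∀ z ∈ Metric.ball (0 : ℂ) 1, deriv h z = deriv H (φ z)) :
    pnorm (PH h g) ≤ pnorm (PH H G) + 2 := by
  have : Nonempty (ball (0 : ℂ) 1) := ⟨⟨0, mem_ball_self one_pos⟩⟩
  refine ciSup_le fun ⟨z, hz⟩ => ?_
  have hle : (1 - ‖φ z‖ ^ 2) * ‖PH H G (φ z)‖ ≤ pnorm (PH H G) :=
    le_ciSup hFfin ⟨φ z, hφmap hz⟩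
  have hz0 := one_sub_sq_norm_pos hz
  have hp0 := one_sub_sq_norm_pos (hφmap hz)
  have h1 := hf.norm_PH_sub_pd_le hz
  have h2 := hF.norm_PH_sub_pd_le (hφmap hz)
  have hpd : (1 - ‖z‖ ^ 2) * ‖pd h z‖ ≤ (1 - ‖φ z‖ ^ 2) * ‖pd H (φ z)‖ := by
    rw [pd_eq_of_deriv_eq_comp hF.1 hφ hφmap hsub hz, norm_mul]
    nlinarith [mul_le_mul_of_nonneg_right (schwarz_pick_deriv hφ hφmap hz)
      (norm_nonneg (pd H (φ z)))]
  have t1 := mul_le_mul_of_nonneg_left (norm_le_norm_add_norm_sub' (PH h g z) (pd h z)) hz0.le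
  have t2 := mul_le_mul_of_nonneg_left
    (norm_le_norm_add_norm_sub (PH H G (φ z)) (pd H (φ z))) hp0.le
  rw [mul_add] at t1 t2
  dsimp only
  linarith
end
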